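/- Fix real numbers m ≠ 0 and ℏ > 0 and a vector v ∈ ℝ³. For a smooth function F : ℝ³ × ℝ → ℂ, the following are equivalent: (i) for every smooth function ψ : ℝ³ × ℝ → ℂ and all (y,t) ∈ ℝ³ × ℝ, S⁰_m( e^{F} · ψ∘τ_v )(y,t) = e^{F(y,t)} · (S⁰_m ψ)(y − t·v, t), where τ_v(y,t) = (y − t·v, t); (ii) there exists a constant c ∈ ℂ such that F(y,t) = (i·m/ℏ)( ⟨v,y⟩ − (t/2)‖v‖² ) + c for all (y,t). -/

import Mathlib

open scoped BigOperators

/-- Partial derivative of `ψ : ℝ³ × ℝ → ℂ` in the spatial direction `y_k`. -/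
noncomputable def pdy (ψ : (Fin 3 → ℝ) × ℝ → ℂ) (k : Fin 3) (p : (Fin 3 → ℝ) × ℝ) : ℂ :=
  deriv (fun s : ℝ => ψ (Function.update p.1 k s, p.2)) (p.1 k)

/-- Partial derivative of `ψ : ℝ³ × ℝ → ℂ` in the time direction `t`. -/
noncomputable def pdt (ψ : (Fin 3 → ℝ) × ℝ → ℂ) (p : (Fin 3 → ℝ) × ℝ) : ℂ :=
  deriv (fun s : ℝ => ψ (p.1, s)) p.2

/-- The free Schrödinger operator
`S⁰_m ψ = (ℏ²/(2m)) Σ_k ∂²ψ/∂y_k² + iℏ ∂ψ/∂t`. -/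
noncomputable def freeSchrodingerOp (m hbar : ℝ) (ψ : (Fin 3 → ℝ) × ℝ → ℂ)
    (p : (Fin 3 → ℝ) × ℝ) : ℂ :=
  (hbar ^ 2 / (2 * m)) * ∑ k : Fin 3, pdy (pdy ψ k) k p + Complex.I * hbar * pdt ψ p


theorem hasDerivAt_pdy {ψ : (Fin 3 → ℝ) × ℝ → ℂ} {p : (Fin 3 → ℝ) × ℝ}
    (h : DifferentiableAt ℝ ψ p) (k : Fin 3) :
    HasDerivAt (fun s : ℝ => ψ (Function.update p.1 k s, p.2))
      (fderiv ℝ ψ p (Pi.single k 1, 0)) (p.1 k) := by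
  have h1 : HasDerivAt (fun s : ℝ => (Function.update p.1 k s, p.2))
      ((Pi.single k 1 : Fin 3 → ℝ), (0 : ℝ)) (p.1 k) :=
    (hasDerivAt_update p.1 k (p.1 k)).prodMk (hasDerivAt_const _ _)
  have h2 : HasFDerivAt ψ (fderiv ℝ ψ p) (Function.update p.1 k (p.1 k), p.2) := by
    simpa using h.hasFDerivAt
  exact h2.comp_hasDerivAt (p.1 k) h1

theorem pdy_eq {ψ : (Fin 3 → ℝ) × ℝ → ℂ} {p : (Fin 3 → ℝ) × ℝ}
    (h : DifferentiableAt ℝ ψ p) (k : Fin 3) :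
    pdy ψ k p = fderiv ℝ ψ p (Pi.single k 1, 0) :=
  (hasDerivAt_pdy h k).deriv

theorem pdt_eq {ψ : (Fin 3 → ℝ) × ℝ → ℂ} {p : (Fin 3 → ℝ) × ℝ}
    (h : DifferentiableAt ℝ ψ p) :
    pdt ψ p = fderiv ℝ ψ p (0, 1) := by
  have h1 : HasDerivAt (fun s : ℝ => (p.1, s)) ((0 : Fin 3 → ℝ), (1 : ℝ)) p.2 :=
    (hasDerivAt_const _ _).prodMk (hasDerivAt_id _)
  have h2 : HasFDerivAt ψ (fderiv ℝ ψ p) (p.1, p.2) := h.hasFDerivAt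
  exact (h2.comp_hasDerivAt p.2 h1).deriv

theorem contDiff_pdy {ψ : (Fin 3 → ℝ) × ℝ → ℂ} (h : ContDiff ℝ (⊤ : ℕ∞) ψ) (k : Fin 3) :
    ContDiff ℝ (⊤ : ℕ∞) (pdy ψ k) := by
  have hd : Differentiable ℝ ψ := h.differentiable (by simp)
  have : pdy ψ k = fun p => fderiv ℝ ψ p (Pi.single k 1, 0) := funext fun p => pdy_eq (hd p) k
  rw [this]
  exact (h.fderiv_right (m := (⊤ : ℕ∞)) (by simp)).clm_apply contDiff_const

theorem fderiv_split {ψ : (Fin 3 → ℝ) × ℝ → ℂ} (h : Differentiable ℝ ψ)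
    (p w : (Fin 3 → ℝ) × ℝ) :
    fderiv ℝ ψ p w = (∑ k, (w.1 k : ℂ) * pdy ψ k p) + (w.2 : ℂ) * pdt ψ p := by
  have hw : w = (∑ k, w.1 k • ((Pi.single k 1 : Fin 3 → ℝ), (0 : ℝ))) +
      w.2 • ((0 : Fin 3 → ℝ), (1 : ℝ)) := by
    ext j
    · fin_cases j <;> simp [Fin.sum_univ_three, Pi.single_apply]
    · simp [Fin.sum_univ_three]
  conv_lhs => rw [hw]
  rw [map_add, map_sum, map_smul, pdt_eq (h p)]
  simp only [map_smul, Complex.real_smul, pdy_eq (h p)]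

/-- the Galilean boost -/
def boost (v : Fin 3 → ℝ) (q : (Fin 3 → ℝ) × ℝ) : (Fin 3 → ℝ) × ℝ := (q.1 - q.2 • v, q.2)

theorem contDiff_boost (v : Fin 3 → ℝ) : ContDiff ℝ (⊤ : ℕ∞) (boost v) := by
  unfold boost; fun_prop

theorem fderiv_comp_boost {ψ : (Fin 3 → ℝ) × ℝ → ℂ} (h : Differentiable ℝ ψ)
    (v : Fin 3 → ℝ) (p w : (Fin 3 → ℝ) × ℝ) :
    fderiv ℝ (fun q => ψ (boost v q)) p w = fderiv ℝ ψ (boost v p) (boost v w) := by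
  have hb : HasFDerivAt (boost v)
      ((ContinuousLinearMap.fst ℝ (Fin 3 → ℝ) ℝ - (ContinuousLinearMap.snd ℝ (Fin 3 → ℝ) ℝ).smulRight v).prod
        (ContinuousLinearMap.snd ℝ (Fin 3 → ℝ) ℝ)) p :=
    ContinuousLinearMap.hasFDerivAt
      ((ContinuousLinearMap.fst ℝ (Fin 3 → ℝ) ℝ - (ContinuousLinearMap.snd ℝ (Fin 3 → ℝ) ℝ).smulRight v).prod
        (ContinuousLinearMap.snd ℝ (Fin 3 → ℝ) ℝ))
  change fderiv ℝ (ψ ∘ boost v) p w = _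
  rw [((h (boost v p)).hasFDerivAt.comp p hb).fderiv]
  rfl

theorem pdy_comp_boost {ψ : (Fin 3 → ℝ) × ℝ → ℂ} (h : Differentiable ℝ ψ)
    (v : Fin 3 → ℝ) (k : Fin 3) (p : (Fin 3 → ℝ) × ℝ) :
    pdy (fun q => ψ (boost v q)) k p = pdy ψ k (boost v p) := by
  have hb := (contDiff_boost v).differentiable (by simp)
  rw [pdy_eq (show DifferentiableAt ℝ (fun q => ψ (boost v q)) p from (h _).comp p (hb p)), pdy_eq (h _)]
  refine (fderiv_comp_boost h v p _).trans ?_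
  simp [boost]

theorem pdt_comp_boost {ψ : (Fin 3 → ℝ) × ℝ → ℂ} (h : Differentiable ℝ ψ)
    (v : Fin 3 → ℝ) (p : (Fin 3 → ℝ) × ℝ) :
    pdt (fun q => ψ (boost v q)) p
      = pdt ψ (boost v p) - ∑ k, (v k : ℂ) * pdy ψ k (boost v p) := by
  have hb := (contDiff_boost v).differentiable (by simp)
  rw [pdt_eq (show DifferentiableAt ℝ (fun q => ψ (boost v q)) p from (h _).comp p (hb p))]
  refine (fderiv_comp_boost h v p _).trans ?_
  rw [fderiv_split h]
  simp [boost]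
  ring

theorem fderiv_exp_mul {F H : (Fin 3 → ℝ) × ℝ → ℂ} (hF : Differentiable ℝ F)
    (hH : Differentiable ℝ H) (p w : (Fin 3 → ℝ) × ℝ) :
    fderiv ℝ (fun q => Complex.exp (F q) * H q) p w
      = Complex.exp (F p) * (fderiv ℝ F p w * H p + fderiv ℝ H p w) := by
  rw [((hF p).hasFDerivAt.cexp.fun_mul (hH p).hasFDerivAt).fderiv]
  simp
  ring

theorem pdy_exp_mul {F H : (Fin 3 → ℝ) × ℝ → ℂ} (hF : Differentiable ℝ F)
    (hH : Differentiable ℝ H) (k : Fin 3) (p : (Fin 3 → ℝ) × ℝ) :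
    pdy (fun q => Complex.exp (F q) * H q) k p
      = Complex.exp (F p) * (pdy F k p * H p + pdy H k p) := by
  rw [pdy_eq (hF p), pdy_eq (hH p), pdy_eq ((hF p).cexp.fun_mul (hH p))]
  exact fderiv_exp_mul hF hH p _

theorem pdt_exp_mul {F H : (Fin 3 → ℝ) × ℝ → ℂ} (hF : Differentiable ℝ F)
    (hH : Differentiable ℝ H) (p : (Fin 3 → ℝ) × ℝ) :
    pdt (fun q => Complex.exp (F q) * H q) p
      = Complex.exp (F p) * (pdt F p * H p + pdt H p) := by
  rw [pdt_eq (hF p), pdt_eq (hH p), pdt_eq ((hF p).cexp.fun_mul (hH p))]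
  exact fderiv_exp_mul hF hH p _

theorem pdy_mul_add {A B C : (Fin 3 → ℝ) × ℝ → ℂ} (hA : Differentiable ℝ A)
    (hB : Differentiable ℝ B) (hC : Differentiable ℝ C) (k : Fin 3) (p : (Fin 3 → ℝ) × ℝ) :
    pdy (fun q => A q * B q + C q) k p
      = pdy A k p * B p + A p * pdy B k p + pdy C k p := by
  rw [pdy_eq (hA p), pdy_eq (hB p), pdy_eq (hC p), pdy_eq (((hA p).fun_mul (hB p)).fun_add (hC p))]
  rw [(((hA p).hasFDerivAt.fun_mul (hB p).hasFDerivAt).fun_add (hC p).hasFDerivAt).fderiv]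
  simp
  ring

theorem op_expand (m hbar : ℝ) (v : Fin 3 → ℝ)
    {F ψ : (Fin 3 → ℝ) × ℝ → ℂ} (hF : ContDiff ℝ (⊤ : ℕ∞) F) (hψ : ContDiff ℝ (⊤ : ℕ∞) ψ)
    (p : (Fin 3 → ℝ) × ℝ) :
    freeSchrodingerOp m hbar (fun q => Complex.exp (F q) * ψ (boost v q)) p
      = Complex.exp (F p) * (freeSchrodingerOp m hbar ψ (boost v p)
        + ((hbar ^ 2 / (2 * m)) * ∑ k : Fin 3, (pdy (pdy F k) k p + pdy F k p ^ 2)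
            + Complex.I * hbar * pdt F p) * ψ (boost v p)
        + ∑ k : Fin 3, ((hbar ^ 2 / (2 * m)) * 2 * pdy F k p - Complex.I * hbar * v k)
            * pdy ψ k (boost v p)) := by
  have dF := hF.differentiable (by simp)
  have dψ := hψ.differentiable (by simp)
  have dFk := fun k => (contDiff_pdy hF k).differentiable (by simp)
  have dψk := fun k => (contDiff_pdy hψ k).differentiable (by simp)
  have hb := (contDiff_boost v).differentiable (by simp)
  have dψb : Differentiable ℝ (fun q => ψ (boost v q)) := dψ.comp hb
  have dψkb : ∀ k, Differentiable ℝ (fun q => pdy ψ k (boost v q)) := fun k => (dψk k).comp hb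
  have e1 : ∀ k, pdy (fun q => Complex.exp (F q) * ψ (boost v q)) k
      = fun q => Complex.exp (F q) * (pdy F k q * ψ (boost v q) + pdy ψ k (boost v q)) := by
    intro k
    funext q
    rw [pdy_exp_mul dF dψb, pdy_comp_boost dψ]
  have e2 : ∀ k, pdy (pdy (fun q => Complex.exp (F q) * ψ (boost v q)) k) k p
      = Complex.exp (F p) * (pdy F k p * (pdy F k p * ψ (boost v p) + pdy ψ k (boost v p))
        + (pdy (pdy F k) k p * ψ (boost v p) + pdy F k p * pdy ψ k (boost v p)
          + pdy (pdy ψ k) k (boost v p))) := by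
    intro k
    rw [e1, pdy_exp_mul dF (((dFk k).fun_mul dψb).fun_add (dψkb k)), pdy_mul_add (dFk k) dψb (dψkb k),
      pdy_comp_boost dψ, pdy_comp_boost (dψk k)]
  unfold freeSchrodingerOp
  simp only [e2]
  rw [pdt_exp_mul dF dψb, pdt_comp_boost dψ]
  simp only [Fin.sum_univ_three]
  ring

/-- the explicit phase -/
noncomputable def phase (m hbar : ℝ) (v : Fin 3 → ℝ) (p : (Fin 3 → ℝ) × ℝ) : ℂ :=
  Complex.I * m / hbar *
          (((∑ k : Fin 3, v k * p.1 k : ℝ) : ℂ)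
            - ((p.2 / 2 : ℝ) : ℂ) * ((∑ k : Fin 3, v k * v k : ℝ) : ℂ))

theorem contDiff_ofReal' {f : (Fin 3 → ℝ) × ℝ → ℝ} (hf : ContDiff ℝ (⊤ : ℕ∞) f) :
    ContDiff ℝ (⊤ : ℕ∞) (fun p => (f p : ℂ)) :=
  Complex.ofRealCLM.contDiff.comp hf

theorem contDiff_phase (m hbar : ℝ) (v : Fin 3 → ℝ) :
    ContDiff ℝ (⊤ : ℕ∞) (phase m hbar v) := by
  unfold phase
  refine contDiff_const.mul (ContDiff.sub (contDiff_ofReal' ?_)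
    (ContDiff.mul (contDiff_ofReal' ?_) contDiff_const))
  · fun_prop
  · fun_prop

theorem pdy_phase (m hbar : ℝ) (v : Fin 3 → ℝ) (k : Fin 3) (p : (Fin 3 → ℝ) × ℝ) :
    pdy (phase m hbar v) k p = Complex.I * m / hbar * v k := by
  unfold pdy phase
  dsimp only
  have h : HasDerivAt (fun s : ℝ => ∑ j : Fin 3, v j * Function.update p.1 k s j) (v k) (p.1 k) := by
    have := HasDerivAt.fun_sum (u := Finset.univ) (fun j (_ : j ∈ Finset.univ) =>
      ((hasDerivAt_pi.1 (hasDerivAt_update p.1 k (p.1 k))) j).const_mul (v j))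
    simpa [Pi.single_apply] using this
  exact ((h.ofReal_comp.sub_const _).const_mul _).deriv

theorem pdt_phase (m hbar : ℝ) (v : Fin 3 → ℝ) (p : (Fin 3 → ℝ) × ℝ) :
    pdt (phase m hbar v) p
      = - (Complex.I * m / hbar * (1 / 2) * ∑ k : Fin 3, (v k : ℂ) ^ 2) := by
  unfold pdt phase
  dsimp only
  have h : HasDerivAt (fun s : ℝ => s / 2) (1 / 2) p.2 := (hasDerivAt_id _).div_const 2
  refine (((h.ofReal_comp.mul_const _).const_sub _).const_mul _).deriv.trans ?_
  simp [Fin.sum_univ_three]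
  ring

theorem pdy_const_fun (c : ℂ) (k : Fin 3) (p : (Fin 3 → ℝ) × ℝ) :
    pdy (fun _ => c) k p = 0 := by
  unfold pdy; simp

theorem pdt_const_fun (c : ℂ) (p : (Fin 3 → ℝ) × ℝ) :
    pdt (fun _ => c) p = 0 := by
  unfold pdt; simp

theorem pdy_coord (j k : Fin 3) (p : (Fin 3 → ℝ) × ℝ) :
    pdy (fun q => ((q.1 j : ℝ) : ℂ)) k p = if j = k then 1 else 0 := by
  unfold pdy
  have h := ((hasDerivAt_pi.1 (hasDerivAt_update p.1 k (p.1 k))) j).ofReal_comp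
  refine h.deriv.trans ?_
  by_cases hjk : j = k <;> simp [Pi.single_apply, hjk]

theorem partials_iff (m hbar : ℝ) (v : Fin 3 → ℝ)
    (F : (Fin 3 → ℝ) × ℝ → ℂ) (hF : ContDiff ℝ (⊤ : ℕ∞) F) :
    (∃ c : ℂ, ∀ p, F p = phase m hbar v p + c) ↔
      ((∀ k p, pdy F k p = Complex.I * m / hbar * v k) ∧
        ∀ p, pdt F p = - (Complex.I * m / hbar * (1 / 2) * ∑ k : Fin 3, (v k : ℂ) ^ 2)) := by
  have dF := hF.differentiable (by simp)
  have dP := (contDiff_phase m hbar v).differentiable (by simp)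
  constructor
  · rintro ⟨c, hc⟩
    have hFe : F = fun p => phase m hbar v p + c := funext hc
    have hfd : ∀ p, fderiv ℝ F p = fderiv ℝ (phase m hbar v) p := by
      intro p; rw [hFe, fderiv_add_const]
    refine ⟨fun k p => ?_, fun p => ?_⟩
    · rw [← pdy_phase m hbar v k p, pdy_eq (dF p), pdy_eq (dP p), hfd]
    · rw [← pdt_phase m hbar v p, pdt_eq (dF p), pdt_eq (dP p), hfd]
  · rintro ⟨h1, h2⟩
    have hz : ∀ p, fderiv ℝ (fun q => F q - phase m hbar v q) p = 0 := by
      intro p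
      rw [((dF p).hasFDerivAt.fun_sub (dP p).hasFDerivAt).fderiv]
      refine ContinuousLinearMap.ext fun w => ?_
      rw [ContinuousLinearMap.sub_apply, fderiv_split dF, fderiv_split dP]
      simp only [h1, h2, pdy_phase, pdt_phase]
      simp
    refine ⟨F 0 - phase m hbar v 0, fun p => ?_⟩
    have := is_const_of_fderiv_eq_zero (𝕜 := ℝ) (dF.sub dP) hz p 0
    simp only [Pi.sub_apply] at this
    rw [← this]; ring

/-- A smooth phase function `F` makes the gauge transformation
`ψ ↦ e^F · ψ∘τ_v` (with `τ_v(y,t) = (y − t·v, t)`) intertwine the free Schrödinger operator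
if and only if `F(y,t) = (i·m/ℏ)(⟨v,y⟩ − (t/2)‖v‖²) + c` for some constant `c`. -/
theorem gauge_intertwines_iff_phase_eq
    (m hbar : ℝ) (hm : m ≠ 0) (hh : 0 < hbar) (v : Fin 3 → ℝ)
    (F : (Fin 3 → ℝ) × ℝ → ℂ) (hF : ContDiff ℝ (⊤ : ℕ∞) F) :
    (∀ ψ : (Fin 3 → ℝ) × ℝ → ℂ, ContDiff ℝ (⊤ : ℕ∞) ψ →
      ∀ p : (Fin 3 → ℝ) × ℝ,
        freeSchrodingerOp m hbar
          (fun q => Complex.exp (F q) * ψ (q.1 - q.2 • v, q.2)) p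
        = Complex.exp (F p) * freeSchrodingerOp m hbar ψ (p.1 - p.2 • v, p.2))
    ↔ (∃ c : ℂ, ∀ p : (Fin 3 → ℝ) × ℝ,
        F p = Complex.I * m / hbar *
          (((∑ k : Fin 3, v k * p.1 k : ℝ) : ℂ)
            - ((p.2 / 2 : ℝ) : ℂ) * ((∑ k : Fin 3, v k * v k : ℝ) : ℂ)) + c) := by
  have hmC : (m : ℂ) ≠ 0 := by exact_mod_cast hm
  have hhC : (hbar : ℂ) ≠ 0 := by exact_mod_cast hh.ne'
  refine Iff.trans ?_ (partials_iff m hbar v F hF).symm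
  have key : ∀ a b c : ℂ, ∀ z : ℂ, (Complex.exp z * (a + b + c) = Complex.exp z * a) ↔
      b + c = 0 := by
    intro a b c z
    rw [mul_right_inj' (Complex.exp_ne_zero z), add_assoc, add_eq_left]
  have hI := Complex.I_sq
  constructor
  · intro H
    have H' : ∀ ψ : (Fin 3 → ℝ) × ℝ → ℂ, ContDiff ℝ (⊤ : ℕ∞) ψ → ∀ p, _ = (0 : ℂ) :=
      fun ψ hψ p => (key _ _ _ _).1 ((op_expand m hbar v hF hψ p).symm.trans (H ψ hψ p))
    have A : ∀ p, (hbar ^ 2 / (2 * m)) * ∑ k : Fin 3, (pdy (pdy F k) k p + pdy F k p ^ 2)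
            + Complex.I * hbar * pdt F p = 0 := by
      intro p
      have := H' (fun _ => 1) contDiff_const p
      simpa [pdy_const_fun] using this
    have B : ∀ k p, pdy F k p = Complex.I * m / hbar * v k := by
      intro k p
      have := H' (fun q => ((q.1 k : ℝ) : ℂ)) (contDiff_ofReal' (by fun_prop)) p
      rw [A p] at this
      simp only [pdy_coord, zero_mul, zero_add, mul_ite, mul_one, mul_zero,
        Finset.sum_ite_eq, Finset.mem_univ, if_true] at this
      field_simp at this ⊢
      apply mul_left_cancel₀ hhC
      linear_combination this
    refine ⟨B, fun p => ?_⟩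
    have A' := A p
    have e : ∀ k, pdy F k = fun _ => Complex.I * m / hbar * v k := fun k => funext (B k)
    simp only [e, pdy_const_fun, zero_add, mul_pow, ← Finset.mul_sum] at A'
    field_simp at A' ⊢
    apply mul_left_cancel₀ Complex.I_ne_zero
    linear_combination A'
  · rintro ⟨B, C⟩ ψ hψ p
    refine (op_expand m hbar v hF hψ p).trans ((key _ _ _ _).2 ?_)
    have e : ∀ k, pdy F k = fun _ => Complex.I * m / hbar * v k := fun k => funext (B k)
    simp only [e, C, pdy_const_fun, zero_add, mul_pow, ← Finset.mul_sum]
    have z : ∀ k, ((hbar : ℂ) ^ 2 / (2 * m)) * 2 * (Complex.I * m / hbar * v k)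
        - Complex.I * hbar * v k = 0 := by
      intro k; field_simp; ring
    simp only [z, zero_mul, Finset.sum_const_zero, add_zero]
    refine mul_eq_zero_of_left ?_ _
    field_simp
    ring
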